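/- There exists an absolute constant C such that the following holds. Let h ∈ ℝ^N be (c,p)-compressible in the Fourier basis with p ≥ 2 and c > 0, and let ε > 0, δ ∈ (0,1). Then there exists an (ε,δ)-differentially private algorithm 𝒜 approximating x ↦ Hx whose mean squared error satisfies sup_x (1/N)·E[‖𝒜(x) − Hx‖₂²] ≤ C·c·(1 + ln N)²·ln(1/δ)/(N·ε²) when p = 2, and ≤ C·c·(p/(p−2))²·ln(1/δ)/(N·ε²) when p > 2. -/

import Mathlib

open MeasureTheory Finset
open scoped ENNReal NNReal

noncomputable section

/-- `(ε,δ)`-differential privacy for a randomized algorithm mapping inputs in `[0,1]^N`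
(ℓ₁-neighboring inputs differ by at most 1 in ℓ₁ norm) to probability measures on `Ω`. -/
def DiffPrivate {N : ℕ} {Ω : Type*} [MeasurableSpace Ω]
    (A : (Fin N → ℝ) → Measure Ω) (ε δ : ℝ) : Prop :=
  ∀ x x' : Fin N → ℝ,
    (∀ i, x i ∈ Set.Icc (0 : ℝ) 1) → (∀ i, x' i ∈ Set.Icc (0 : ℝ) 1) →
    (∑ i, |x i - x' i|) ≤ 1 →
    ∀ T : Set Ω, MeasurableSet T →
      A x T ≤ ENNReal.ofReal (Real.exp ε) * A x' T + ENNReal.ofReal δ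

/-- The normalized DFT matrix `(F_N)_{m,n} = N^{-1/2} exp(-2π i m n / N)`. -/
def dftMatrix (N : ℕ) : Matrix (Fin N) (Fin N) ℂ :=
  Matrix.of fun m n => ((Real.sqrt N : ℝ) : ℂ)⁻¹ *
    Complex.exp (-(2 * (Real.pi : ℂ) * Complex.I * ((m : ℕ) : ℂ) * ((n : ℕ) : ℂ)) / (N : ℂ))

/-- The normalized DFT (Fourier coefficients) of a real vector: `ĥ = F_N h`. -/
def dftCoeff {N : ℕ} (h : Fin N → ℝ) : Fin N → ℂ :=
  (dftMatrix N).mulVec fun n => ((h n : ℝ) : ℂ)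

lemma lap_integrable (m : ℕ) : Integrable (fun t : ℝ => t ^ m * Real.exp (-|t|)) := by
  have h1 : IntegrableOn (fun t : ℝ => t ^ m * Real.exp (-t)) (Set.Ioi 0) := by
    have := Real.GammaIntegral_convergent (s := (m : ℝ) + 1) (by positivity)
    refine this.congr_fun (fun t ht => ?_) measurableSet_Ioi
    simp [mul_comm]
  have h2 : IntegrableOn (fun t : ℝ => t ^ m * Real.exp (-|t|)) (Set.Ioi 0) := by
    refine h1.congr_fun (fun t ht => ?_) measurableSet_Ioi
    simp only [abs_of_pos (Set.mem_Ioi.1 ht)]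
  have h3 : IntegrableOn (fun t : ℝ => t ^ m * Real.exp (-|t|)) (Set.Iic 0) := by
    rw [integrableOn_Iic_iff_integrableOn_Iio]
    have h4 := ((Measure.measurePreserving_neg (volume : Measure ℝ)).integrableOn_comp_preimage
      (Homeomorph.neg ℝ).measurableEmbedding).2 h2
    have h5 : IntegrableOn (fun t : ℝ => (-1) ^ m * ((-t) ^ m * Real.exp (-|-t|))) (Set.Iio 0) := by
      have : (Neg.neg ⁻¹' (Set.Ioi 0) : Set ℝ) = Set.Iio 0 := by ext; simp
      rw [this] at h4
      exact h4.const_mul _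
    refine h5.congr_fun (fun t _ => ?_) measurableSet_Iio
    simp only [abs_neg]
    rw [← mul_assoc, ← mul_pow]; simp
  rw [← integrableOn_univ, ← Set.Iic_union_Ioi (a := (0 : ℝ))]
  exact h3.union h2

lemma lap_int_pos (m : ℕ) : ∫ t in Set.Ioi (0:ℝ), t ^ m * Real.exp (-t) = m.factorial := by
  rw [← Real.Gamma_nat_eq_factorial, Real.Gamma_eq_integral (by positivity)]
  refine setIntegral_congr_fun measurableSet_Ioi (fun t ht => ?_)
  simp [mul_comm]

lemma lap_int0 : ∫ t : ℝ, Real.exp (-|t|) = 2 := by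
  have := integral_comp_abs (f := fun t => Real.exp (-t))
  have h := lap_int_pos 0
  simp at h
  rw [this]; simp [h]

lemma lap_int2 : ∫ t : ℝ, t ^ 2 * Real.exp (-|t|) = 4 := by
  have := integral_comp_abs (f := fun t => t ^ 2 * Real.exp (-t))
  have h := lap_int_pos 2
  simp only [sq_abs] at this
  rw [this, h]; norm_num [Nat.factorial]

lemma lap_int1 : ∫ t : ℝ, t * Real.exp (-|t|) = 0 := by
  have := integral_neg_eq_self (fun t : ℝ => t * Real.exp (-|t|)) volume
  simp only [abs_neg, neg_mul, integral_neg] at this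
  linarith

/-- joint density -/
def lapDens {ι : Type*} [Fintype ι] (z : ι → ℝ) : ℝ := ∏ i, (1 / 2 * Real.exp (-|z i|))

lemma lapDens_nonneg {ι : Type*} [Fintype ι] (z : ι → ℝ) : 0 ≤ lapDens z :=
  Finset.prod_nonneg (fun _ _ => by positivity)

lemma lapDens_meas {ι : Type*} [Fintype ι] : Measurable (lapDens : (ι → ℝ) → ℝ) := by
  unfold lapDens
  fun_prop

/-- joint law -/
def lapMeas (ι : Type*) [Fintype ι] : Measure (ι → ℝ) :=
  volume.withDensity (fun z => ENNReal.ofReal (lapDens z))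

lemma lapDens_integrable {ι : Type*} [Fintype ι] : Integrable (lapDens : (ι → ℝ) → ℝ) := by
  refine Integrable.fintype_prod (f := fun _ t => 1 / 2 * Real.exp (-|t|)) (fun i => ?_)
  simpa using (lap_integrable 0).const_mul (1/2)

lemma lapDens_integral {ι : Type*} [Fintype ι] : ∫ z : ι → ℝ, lapDens z = 1 := by
  unfold lapDens
  rw [integral_fintype_prod_volume_eq_prod (fun (_ : ι) t => 1 / 2 * Real.exp (-|t|))]
  simp [integral_const_mul, lap_int0]

instance {ι : Type*} [Fintype ι] : IsProbabilityMeasure (lapMeas ι) := by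
  constructor
  rw [lapMeas, withDensity_apply _ MeasurableSet.univ, Measure.restrict_univ,
    ← ofReal_integral_eq_lintegral_ofReal lapDens_integrable
      (Filter.Eventually.of_forall lapDens_nonneg), lapDens_integral]
  simp

lemma lapDens_cross_eq {ι : Type*} [Fintype ι] [DecidableEq ι] (i j : ι) (z : ι → ℝ) :
    lapDens z * (z i * z j) = ∏ k, (1 / 2 *
      (z k ^ ((if k = i then 1 else 0) + (if k = j then 1 else 0)) * Real.exp (-|z k|))) := by
  unfold lapDens
  have : ∀ k, (1 / 2 *
      (z k ^ ((if k = i then 1 else 0) + (if k = j then 1 else 0)) * Real.exp (-|z k|)))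
      = (1 / 2 * Real.exp (-|z k|)) * ((if k = i then z k else 1) * (if k = j then z k else 1)) := by
    intro k
    split_ifs <;> ring
  simp_rw [this, Finset.prod_mul_distrib]
  simp

lemma lapDens_cross {ι : Type*} [Fintype ι] [DecidableEq ι] (i j : ι) :
    Integrable (fun z : ι → ℝ => lapDens z * (z i * z j)) ∧
    ∫ z : ι → ℝ, lapDens z * (z i * z j) = if i = j then 2 else 0 := by
  simp_rw [lapDens_cross_eq]
  constructor
  · exact Integrable.fintype_prod (f := fun k t => 1 / 2 *
      (t ^ ((if k = i then 1 else 0) + (if k = j then 1 else 0)) * Real.exp (-|t|)))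
      (fun k => (lap_integrable _).const_mul _)
  · rw [integral_fintype_prod_volume_eq_prod (fun (k : ι) t => 1 / 2 *
      (t ^ ((if k = i then 1 else 0) + (if k = j then 1 else 0)) * Real.exp (-|t|)))]
    simp_rw [integral_const_mul]
    split_ifs with h
    · subst h
      rw [Finset.prod_eq_single i]
      · simp [lap_int2]; norm_num
      · intro k _ hk
        simp [hk, lap_int0]
      · simp
    · refine Finset.prod_eq_zero (Finset.mem_univ i) ?_
      simp [h, lap_int1]

lemma lap_second {ι : Type*} [Fintype ι] (b : ι → ℝ) :
    ∫⁻ z, ENNReal.ofReal ((∑ i, b i * z i) ^ 2) ∂(lapMeas ι) = ENNReal.ofReal (2 * ∑ i, b i ^ 2) := by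
  classical
  have hm : Measurable (fun z : ι → ℝ => (∑ i, b i * z i) ^ 2) := by fun_prop
  rw [lapMeas, lintegral_withDensity_eq_lintegral_mul _ lapDens_meas.ennreal_ofReal
    hm.ennreal_ofReal]
  have e : ∀ z : ι → ℝ, lapDens z * (∑ i, b i * z i) ^ 2
      = ∑ i, ∑ j, (b i * b j) * (lapDens z * (z i * z j)) := by
    intro z
    rw [sq, Finset.sum_mul_sum, Finset.mul_sum]
    refine Finset.sum_congr rfl fun i _ => ?_
    rw [Finset.mul_sum]
    exact Finset.sum_congr rfl fun j _ => by ring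
  have hi : ∀ i j, Integrable (fun z : ι → ℝ => (b i * b j) * (lapDens z * (z i * z j))) :=
    fun i j => (lapDens_cross i j).1.const_mul _
  have key : ∀ z : ι → ℝ, ((fun z : ι → ℝ => ENNReal.ofReal (lapDens z)) *
      (fun z : ι → ℝ => ENNReal.ofReal ((∑ i, b i * z i) ^ 2)) : (ι → ℝ) → ℝ≥0∞) z
      = ENNReal.ofReal (∑ i, ∑ j, (b i * b j) * (lapDens z * (z i * z j))) := by
    intro z
    rw [← e, ENNReal.ofReal_mul (lapDens_nonneg z)]; rfl
  rw [lintegral_congr key]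
  rw [← ofReal_integral_eq_lintegral_ofReal]
  · congr 1
    rw [integral_finsetSum _ (fun i _ => integrable_finsetSum _ (fun j _ => hi i j)), Finset.mul_sum]
    refine Finset.sum_congr rfl fun i _ => ?_
    rw [integral_finsetSum _ (fun j _ => hi i j)]
    simp_rw [integral_const_mul, (lapDens_cross i _).2]
    simp; ring
  · exact integrable_finsetSum _ (fun i _ => integrable_finsetSum _ (fun j _ => hi i j))
  · refine Filter.Eventually.of_forall fun z => ?_
    simp only [← e]
    exact mul_nonneg (lapDens_nonneg z) (sq_nonneg _)

lemma lapDens_shift {ι : Type*} [Fintype ι] (s z : ι → ℝ) :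
    lapDens (z - s) ≤ Real.exp (∑ i, |s i|) * lapDens z := by
  unfold lapDens
  rw [Real.exp_sum, ← Finset.prod_mul_distrib]
  refine Finset.prod_le_prod (fun _ _ => by positivity) fun i _ => ?_
  have : Real.exp (-|(z - s) i|) ≤ Real.exp |s i| * Real.exp (-|z i|) := by
    rw [← Real.exp_add]
    apply Real.exp_le_exp.2
    have := abs_sub_abs_le_abs_sub (z i) (s i)
    simp only [Pi.sub_apply]; linarith
  linarith

lemma lap_shift {ι : Type*} [Fintype ι] (s : ι → ℝ) (S : Set (ι → ℝ)) (hS : MeasurableSet S) :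
    lapMeas ι ((fun z => z + s) ⁻¹' S) ≤ ENNReal.ofReal (Real.exp (∑ i, |s i|)) * lapMeas ι S := by
  have hS' : MeasurableSet ((fun z => z + s) ⁻¹' S) := hS.preimage (by fun_prop)
  rw [lapMeas, withDensity_apply _ hS', withDensity_apply _ hS, ← lintegral_indicator hS',
    ← lintegral_indicator hS, ← lintegral_sub_right_eq_self _ s,
    ← lintegral_const_mul _ ((lapDens_meas.ennreal_ofReal).indicator hS)]
  refine lintegral_mono fun z => ?_
  by_cases hz : z ∈ S
  · simp only [Set.indicator, Set.mem_preimage, sub_add_cancel, hz, if_true]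
    rw [← ENNReal.ofReal_mul (by positivity)]
    exact ENNReal.ofReal_le_ofReal (lapDens_shift s z)
  · simp [Set.indicator, hz]

/-- linear mechanism -/
def mech {N : ℕ} {ι : Type*} [Fintype ι] (B : Fin N → ι → ℝ) (b : ℝ) (u : ι → ℝ) :
    Measure (Fin N → ℂ) :=
  (lapMeas ι).map (fun z i => ((∑ k, B i k * (u k + b * z k) : ℝ) : ℂ))

lemma mech_meas {N : ℕ} {ι : Type*} [Fintype ι] (B : Fin N → ι → ℝ) (b : ℝ) (u : ι → ℝ) :
    Measurable (fun (z : ι → ℝ) (i : Fin N) => ((∑ k, B i k * (u k + b * z k) : ℝ) : ℂ)) := by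
  fun_prop

lemma mech_prob {N : ℕ} {ι : Type*} [Fintype ι] (B : Fin N → ι → ℝ) (b : ℝ) (u : ι → ℝ) :
    IsProbabilityMeasure (mech B b u) :=
  Measure.isProbabilityMeasure_map (mech_meas B b u).aemeasurable

lemma mech_dp {N : ℕ} {ι : Type*} [Fintype ι] (B : Fin N → ι → ℝ) (b : ℝ) (hb : 0 < b)
    (u u' : ι → ℝ) (T : Set (Fin N → ℂ)) (hT : MeasurableSet T) :
    mech B b u T ≤ ENNReal.ofReal (Real.exp ((∑ k, |u k - u' k|) / b)) * mech B b u' T := by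
  rw [mech, mech, Measure.map_apply (mech_meas B b u) hT, Measure.map_apply (mech_meas B b u') hT]
  have := lap_shift (fun k => (u k - u' k) / b) _ (hT.preimage (mech_meas B b u'))
  convert this using 2
  · ext z
    simp only [Set.mem_preimage, Pi.add_apply]
    have : ∀ k, u k + b * z k = u' k + b * (z k + (u k - u' k) / b) := fun k => by
      field_simp; ring
    simp_rw [this]
  · simp_rw [abs_div, abs_of_pos hb, Finset.sum_div]

lemma mech_err {N : ℕ} {ι : Type*} [Fintype ι] (B : Fin N → ι → ℝ) (b : ℝ) (u : ι → ℝ) :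
    ∫⁻ y, ∑ i, (‖y i - ((∑ k, B i k * u k : ℝ) : ℂ)‖₊ : ℝ≥0∞) ^ 2 ∂(mech B b u)
      = ENNReal.ofReal (2 * b ^ 2 * ∑ i, ∑ k, B i k ^ 2) := by
  rw [mech, lintegral_map (by fun_prop) (mech_meas B b u)]
  have : ∀ (z : ι → ℝ) i, (‖((∑ k, B i k * (u k + b * z k) : ℝ) : ℂ) - ((∑ k, B i k * u k : ℝ) : ℂ)‖₊ : ℝ≥0∞) ^ 2
      = ENNReal.ofReal ((∑ k, (b * B i k) * z k) ^ 2) := by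
    intro z i
    rw [← Complex.ofReal_sub, Complex.nnnorm_real, ← Finset.sum_sub_distrib, ← enorm_eq_nnnorm,
      ← ofReal_norm, ← ENNReal.ofReal_pow (norm_nonneg _), Real.norm_eq_abs, sq_abs]
    congr 3
    ext k; ring
  simp_rw [this]
  rw [lintegral_finsetSum _ (fun i _ => by fun_prop)]
  simp_rw [lap_second]
  rw [← ENNReal.ofReal_sum_of_nonneg (fun i _ => by positivity)]
  congr 1
  simp_rw [Finset.mul_sum]
  exact Finset.sum_congr rfl fun i _ => Finset.sum_congr rfl fun k _ => by ring

lemma dftCoeff_eq {N : ℕ} (h : Fin N → ℝ) (k : Fin N) :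
    dftCoeff h k = ((Real.sqrt N : ℝ) : ℂ)⁻¹ *
      ∑ n : Fin N, Complex.exp (-(2 * Real.pi * Complex.I / N)) ^ ((k : ℕ) * (n : ℕ)) * (h n : ℂ) := by
  simp only [dftCoeff, Matrix.mulVec, dotProduct, dftMatrix, Matrix.of_apply, Finset.mul_sum]
  refine Finset.sum_congr rfl fun n _ => ?_
  rw [← Complex.exp_nat_mul, mul_assoc]
  congr 3
  push_cast; ring

lemma zeta_prim (N : ℕ) (hN : N ≠ 0) :
    IsPrimitiveRoot (Complex.exp (-(2 * Real.pi * Complex.I / N))) N := by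
  rw [Complex.exp_neg]
  exact (Complex.isPrimitiveRoot_exp N hN).inv

lemma zeta_conj (N : ℕ) : (starRingEnd ℂ) (Complex.exp (-(2 * Real.pi * Complex.I / N)))
    = (Complex.exp (-(2 * Real.pi * Complex.I / N)))⁻¹ := by
  rw [← Complex.exp_conj, ← Complex.exp_neg]
  congr 1
  have h2 : (starRingEnd ℂ) 2 = 2 := Complex.conj_ofNat 2
  simp [Complex.conj_ofReal, h2, neg_div]

lemma zeta_orth {N : ℕ} (hN : N ≠ 0) (z : ℂ) (hz : IsPrimitiveRoot z N) (n m : Fin N) :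
    ∑ k : Fin N, z ^ ((k : ℕ) * (n : ℕ)) * (z⁻¹) ^ ((k : ℕ) * (m : ℕ)) = if n = m then (N : ℂ) else 0 := by
  have hz0 : z ≠ 0 := hz.ne_zero hN
  have e : ∀ k : Fin N, z ^ ((k : ℕ) * (n : ℕ)) * (z⁻¹) ^ ((k : ℕ) * (m : ℕ))
      = (z ^ (n : ℕ) * (z⁻¹) ^ (m : ℕ)) ^ (k : ℕ) := by
    intro k
    rw [mul_pow, ← pow_mul, ← pow_mul, mul_comm (k : ℕ), mul_comm (k : ℕ)]
  simp_rw [e]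
  rw [Fin.sum_univ_eq_sum_range (fun k => (z ^ (n : ℕ) * (z⁻¹) ^ (m : ℕ)) ^ k)]
  split_ifs with h
  · subst h
    rw [← mul_pow, mul_inv_cancel₀ hz0]; simp
  · have h1 : z ^ (n : ℕ) * (z⁻¹) ^ (m : ℕ) ≠ 1 := by
      intro h1
      apply h
      rw [inv_pow, mul_inv_eq_one₀ (pow_ne_zero _ hz0)] at h1
      exact Fin.ext (hz.pow_inj n.2 m.2 h1)
    have h2 := geom_sum_mul (z ^ (n : ℕ) * (z⁻¹) ^ (m : ℕ)) N
    have h3 : (z ^ (n : ℕ) * (z⁻¹) ^ (m : ℕ)) ^ N = 1 := by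
      rw [mul_pow, ← pow_mul, ← pow_mul, mul_comm, mul_comm (m : ℕ), mul_comm (n : ℕ), pow_mul,
        pow_mul, inv_pow, hz.pow_eq_one]; simp
    rw [h3, sub_self] at h2
    exact (mul_eq_zero.1 h2).resolve_right (sub_ne_zero.2 h1)

lemma parseval {N : ℕ} (hN : N ≠ 0) (h : Fin N → ℝ) :
    ∑ k, ‖dftCoeff h k‖ ^ 2 = ∑ n, h n ^ 2 := by
  have hN' : (N : ℂ) ≠ 0 := by exact_mod_cast hN
  have hs : ((Real.sqrt N : ℝ) : ℂ)⁻¹ * ((Real.sqrt N : ℝ) : ℂ)⁻¹ = (N : ℂ)⁻¹ := by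
    rw [← mul_inv, ← Complex.ofReal_mul, Real.mul_self_sqrt (by positivity)]; simp
  apply Complex.ofReal_injective
  push_cast
  simp_rw [← Complex.mul_conj', dftCoeff_eq]
  set z := Complex.exp (-(2 * Real.pi * Complex.I / N)) with hz
  simp_rw [map_mul, map_sum, map_mul, map_pow, map_inv₀, Complex.conj_ofReal]
  rw [show (starRingEnd ℂ) z = z⁻¹ from zeta_conj N]
  have e : ∀ k : Fin N, (((Real.sqrt N : ℝ) : ℂ)⁻¹ * ∑ n : Fin N, z ^ ((k : ℕ) * (n : ℕ)) * (h n : ℂ)) *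
      (((Real.sqrt N : ℝ) : ℂ)⁻¹ * ∑ n : Fin N, z⁻¹ ^ ((k : ℕ) * (n : ℕ)) * (h n : ℂ))
      = ∑ n : Fin N, ∑ m : Fin N, ((N : ℂ)⁻¹ * h n * h m) *
        (z ^ ((k : ℕ) * (n : ℕ)) * (z⁻¹) ^ ((k : ℕ) * (m : ℕ))) := by
    intro k
    rw [mul_mul_mul_comm, hs, Finset.sum_mul_sum, Finset.mul_sum]
    refine Finset.sum_congr rfl fun n _ => ?_
    rw [Finset.mul_sum]
    exact Finset.sum_congr rfl fun m _ => by ring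
  simp_rw [e]
  rw [Finset.sum_comm]
  refine Finset.sum_congr rfl fun n _ => ?_
  rw [Finset.sum_comm]
  simp_rw [← Finset.mul_sum, zeta_orth hN z (zeta_prim N hN)]
  simp; field_simp

lemma dft_symm {N : ℕ} (hN : N ≠ 0) (h : Fin N → ℝ) (k l : Fin N) (hkl : (k : ℕ) + l = N) :
    ‖dftCoeff h k‖ = ‖dftCoeff h l‖ := by
  have : dftCoeff h k = (starRingEnd ℂ) (dftCoeff h l) := by
    simp_rw [dftCoeff_eq]
    have hp := zeta_prim N hN
    have hc := zeta_conj N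
    set z := Complex.exp (-(2 * Real.pi * Complex.I / N)) with hz
    have hz0 : z ≠ 0 := hp.ne_zero hN
    simp_rw [map_mul, map_sum, map_mul, map_pow, map_inv₀, Complex.conj_ofReal, hc]
    congr 1
    refine Finset.sum_congr rfl fun n _ => ?_
    congr 1
    rw [inv_pow]
    apply eq_inv_of_mul_eq_one_left
    rw [← pow_add, ← add_mul, hkl, pow_mul,
      hp.pow_eq_one, one_pow]
  rw [this, RCLike.norm_conj]

lemma dft_zero {N : ℕ} (hN : N ≠ 0) (h : Fin N → ℝ) (k : Fin N) (hk : (k : ℕ) = 0) :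
    ‖dftCoeff h k‖ ^ 2 = (∑ n, h n) ^ 2 / N := by
  rw [dftCoeff_eq]
  simp only [hk, zero_mul, pow_zero, one_mul]
  rw [← Complex.ofReal_sum, norm_mul, norm_inv, Complex.norm_real, Complex.norm_real, mul_pow,
    inv_pow, Real.norm_eq_abs, Real.norm_eq_abs, sq_abs, sq_abs, Real.sq_sqrt (by positivity)]
  field_simp

lemma compress_bd {N : ℕ} (hN : N ≠ 0) (h : Fin N → ℝ) (c p : ℝ) (hc : 0 < c) (hp : 2 ≤ p)
    (hh : ∀ i : Fin N, ‖dftCoeff h i‖ ^ 2 ≤ c / (((i : ℕ) : ℝ) + 1) ^ p) :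
    ∃ a : ℝ, N * a ^ 2 ≤ c ∧ N * ∑ n, (h n - a) ^ 2 ≤ 4 * c := by
  have hNp : (0 : ℝ) < N := by exact_mod_cast Nat.pos_of_ne_zero hN
  have hh2 : ∀ i : Fin N, ‖dftCoeff h i‖ ^ 2 ≤ c / (((i : ℕ) : ℝ) + 1) ^ 2 := by
    intro i
    refine (hh i).trans ?_
    gcongr
    rw [← Real.rpow_natCast]
    exact Real.rpow_le_rpow_of_exponent_le (by linarith [Nat.cast_nonneg (α := ℝ) (i : ℕ)])
      (by exact_mod_cast hp)
  let k0 : Fin N := ⟨0, Nat.pos_of_ne_zero hN⟩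
  have h0 := dft_zero hN h k0 rfl
  have h0' := hh2 k0
  have hbig : ∀ i : Fin N, i ≠ k0 → ‖dftCoeff h i‖ ^ 2 ≤ 4 * c / N ^ 2 := by
    intro i hi
    have hi0 : (i : ℕ) ≠ 0 := fun e => hi (Fin.ext e)
    have aux : ∀ j : Fin N, N ≤ 2 * (j : ℕ) → ‖dftCoeff h j‖ ^ 2 ≤ 4 * c / N ^ 2 := by
      intro j hj
      refine (hh2 j).trans ?_
      have : (N : ℝ) ≤ 2 * ((j : ℕ) : ℝ) := by exact_mod_cast hj
      rw [div_le_div_iff₀ (by positivity) (by positivity)]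
      have h5 : (N : ℝ) ^ 2 ≤ 4 * (((j : ℕ) : ℝ) + 1) ^ 2 := by nlinarith
      nlinarith
    by_cases hle : N ≤ 2 * (i : ℕ)
    · exact aux i hle
    · have hl : N - (i : ℕ) < N := by omega
      rw [dft_symm hN h i ⟨N - i, hl⟩ (by simp only []; omega)]
      exact aux _ (by simp only []; omega)
  refine ⟨(∑ n, h n) / N, ?_, ?_⟩
  · have : N * ((∑ n, h n) / N) ^ 2 = ‖dftCoeff h k0‖ ^ 2 := by rw [h0]; field_simp
    rw [this]; simpa [k0] using h0'
  · have e1 : ∑ n, (h n - (∑ n, h n) / N) ^ 2 = ∑ n, h n ^ 2 - (∑ n, h n) ^ 2 / N := by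
      simp_rw [sub_sq, Finset.sum_add_distrib, Finset.sum_sub_distrib, ← Finset.sum_mul, ← Finset.mul_sum]
      simp; field_simp
      try ring
    rw [e1, ← h0, ← parseval hN, ← Finset.add_sum_erase _ _ (Finset.mem_univ k0), add_sub_cancel_left]
    have : ∑ x ∈ Finset.univ.erase k0, ‖dftCoeff h x‖ ^ 2 ≤ N * (4 * c / N ^ 2) := by
      calc _ ≤ ∑ x ∈ Finset.univ.erase k0, 4 * c / (N : ℝ) ^ 2 :=
            Finset.sum_le_sum fun i hi => hbig i (Finset.ne_of_mem_erase hi)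
        _ ≤ ∑ x : Fin N, 4 * c / (N : ℝ) ^ 2 :=
            Finset.sum_le_sum_of_subset_of_nonneg (Finset.subset_univ _)
              fun _ _ _ => by positivity
        _ = _ := by simp
    calc _ ≤ N * (N * (4 * c / N ^ 2)) := by gcongr
      _ = 4 * c := by field_simp

/-- combined linear map -/
def Bmat {N : ℕ} (h : Fin N → ℝ) (a : ℝ) (i : Fin N) : Option (Fin N) → ℝ
  | none => a
  | some j => Matrix.circulant h i j - a

/-- stacked input -/
def stack {N : ℕ} (x : Fin N → ℝ) : Option (Fin N) → ℝ
  | none => ∑ j, x j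
  | some j => x j

lemma Bmat_stack {N : ℕ} (h : Fin N → ℝ) (a : ℝ) (x : Fin N → ℝ) (i : Fin N) :
    (Matrix.circulant h).mulVec x i = ∑ k, Bmat h a i k * stack x k := by
  simp only [Fintype.sum_option, Bmat, stack, Matrix.mulVec, dotProduct, Finset.mul_sum]
  rw [← Finset.sum_add_distrib]
  exact Finset.sum_congr rfl fun j _ => by ring

lemma Bmat_sq {N : ℕ} (hN : N ≠ 0) (h : Fin N → ℝ) (a : ℝ) :
    ∑ i, ∑ k, Bmat h a i k ^ 2 = N * a ^ 2 + N * ∑ n, (h n - a) ^ 2 := by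
  have : NeZero N := ⟨hN⟩
  simp only [Fintype.sum_option, Bmat, Matrix.circulant_apply]
  rw [Finset.sum_add_distrib]
  have : ∀ i : Fin N, ∑ j, (h (i - j) - a) ^ 2 = ∑ n, (h n - a) ^ 2 := fun i =>
    Equiv.sum_comp (Equiv.subLeft i) (fun n => (h n - a) ^ 2)
  simp_rw [this]
  simp

lemma stack_l1 {N : ℕ} (x x' : Fin N → ℝ) (hx : ∑ i, |x i - x' i| ≤ 1) :
    ∑ k, |stack x k - stack x' k| ≤ 2 := by
  simp only [Fintype.sum_option, stack]
  rw [← Finset.sum_sub_distrib]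
  linarith [Finset.abs_sum_le_sum_abs (fun i => x i - x' i) Finset.univ]

/-- the final algorithm -/
def alg {N : ℕ} (h : Fin N → ℝ) (a ε δ : ℝ) (x : Fin N → ℝ) : Measure (Fin N → ℂ) :=
  ENNReal.ofReal δ • Measure.dirac (fun i => (((Matrix.circulant h).mulVec x i : ℝ) : ℂ)) +
  ENNReal.ofReal (1 - δ) • mech (Bmat h a) (2 / ε) (stack x)

lemma alg_prob {N : ℕ} (h : Fin N → ℝ) (a ε δ : ℝ) (h0 : 0 < δ) (h1 : δ < 1) (x : Fin N → ℝ) :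
    IsProbabilityMeasure (alg h a ε δ x) := by
  constructor
  have := mech_prob (Bmat h a) (2 / ε) (stack x)
  simp only [alg, Measure.add_apply, Measure.smul_apply, measure_univ, smul_eq_mul, mul_one]
  rw [← ENNReal.ofReal_add (by linarith) (by linarith)]
  simp

lemma alg_dp {N : ℕ} (h : Fin N → ℝ) (a ε δ : ℝ) (hε : 0 < ε) :
    DiffPrivate (alg h a ε δ) ε δ := by
  intro x x' _ _ hx T hT
  have hm := mech_dp (Bmat h a) (2 / ε) (by positivity) (stack x) (stack x') T hT
  have hle : Real.exp ((∑ k, |stack x k - stack x' k|) / (2 / ε)) ≤ Real.exp ε := by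
    apply Real.exp_le_exp.2
    rw [div_le_iff₀ (by positivity)]
    have := stack_l1 x x' hx
    field_simp
    linarith
  have hm2 := hm.trans (mul_le_mul_left (ENNReal.ofReal_le_ofReal hle) _)
  simp only [alg, Measure.add_apply, Measure.smul_apply, smul_eq_mul]
  calc _ ≤ ENNReal.ofReal δ * 1 + ENNReal.ofReal (1 - δ) * (ENNReal.ofReal (Real.exp ε) *
          mech (Bmat h a) (2 / ε) (stack x') T) := by
        gcongr
        exact prob_le_one
    _ = ENNReal.ofReal (Real.exp ε) * (ENNReal.ofReal (1 - δ) *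
          mech (Bmat h a) (2 / ε) (stack x') T) + ENNReal.ofReal δ := by ring
    _ ≤ _ := by
        gcongr
        exact le_add_self

lemma alg_err {N : ℕ} (hN : N ≠ 0) (h : Fin N → ℝ) (a ε δ c : ℝ) (hε : 0 < ε) (h0 : 0 < δ)
    (h1 : δ < 1) (hc : 0 < c) (ha : N * a ^ 2 ≤ c) (hb : N * ∑ n, (h n - a) ^ 2 ≤ 4 * c) :
    (⨆ x : Fin N → ℝ, ((N : ℝ≥0∞))⁻¹ *
      ∫⁻ y, ∑ i, (‖y i - (((Matrix.circulant h).mulVec x i : ℝ) : ℂ)‖₊ : ℝ≥0∞) ^ 2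
        ∂(alg h a ε δ x)) ≤
      ENNReal.ofReal (40 * c * Real.log (1 / δ) / ((N : ℝ) * ε ^ 2)) := by
  have hNp : (0 : ℝ) < N := by exact_mod_cast Nat.pos_of_ne_zero hN
  refine iSup_le fun x => ?_
  rw [alg, lintegral_add_measure, lintegral_smul_measure, lintegral_smul_measure,
    lintegral_dirac' _ (by fun_prop)]
  simp_rw [Bmat_stack h a x]
  rw [mech_err, Bmat_sq hN]
  simp only [sub_self, nnnorm_zero, ENNReal.coe_zero, smul_eq_mul]
  rw [← ENNReal.ofReal_mul (by linarith)]
  simp only [ne_eq, OfNat.ofNat_ne_zero, not_false_eq_true, zero_pow, Finset.sum_const_zero,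
    mul_zero, zero_add]
  rw [← ENNReal.ofReal_natCast, ← ENNReal.ofReal_inv_of_pos hNp, ← ENNReal.ofReal_mul (by positivity)]
  apply ENNReal.ofReal_le_ofReal
  have hlog : 1 - δ ≤ Real.log (1 / δ) := by
    have := Real.one_sub_inv_le_log_of_pos (x := 1 / δ) (by positivity)
    simpa using this
  have h3 : (1 - δ) * (2 * (2 / ε) ^ 2 * (N * a ^ 2 + N * ∑ n, (h n - a) ^ 2))
      ≤ Real.log (1 / δ) * (2 * (2 / ε) ^ 2 * (5 * c)) := by
    have : (N * a ^ 2 + N * ∑ n, (h n - a) ^ 2) ≤ 5 * c := by linarith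
    have hl : 0 ≤ Real.log (1 / δ) := by linarith
    gcongr
  calc _ ≤ (N : ℝ)⁻¹ * (Real.log (1 / δ) * (2 * (2 / ε) ^ 2 * (5 * c))) := by gcongr
    _ = _ := by field_simp; ring

/-- private convolution with a `(c,p)`-compressible filter.  If
`|ĥ_i|² ≤ c/(i+1)^p` for all `i` with `p ≥ 2`, then for every `ε > 0`, `δ ∈ (0,1)` there
is an `(ε,δ)`-differentially private algorithm for `x ↦ Hx` with worst-case mean squared
error at most `C c (1 + ln N)² ln(1/δ)/(N ε²)` when `p = 2`, and at most
`C c (p/(p-2))² ln(1/δ)/(N ε²)` when `p > 2`. -/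
theorem compressible_convolution :
    ∃ C : ℝ, 0 < C ∧
      ∀ (N : ℕ) (h : Fin N → ℝ) (c p : ℝ), 0 < c → 2 ≤ p →
        (∀ i : Fin N, ‖dftCoeff h i‖ ^ 2 ≤ c / (((i : ℕ) : ℝ) + 1) ^ p) →
        ∀ ε δ : ℝ, 0 < ε → 0 < δ → δ < 1 →
        ∃ A : (Fin N → ℝ) → Measure (Fin N → ℂ),
          (∀ x, IsProbabilityMeasure (A x)) ∧
          DiffPrivate A ε δ ∧
          (p = 2 →
            (⨆ x : Fin N → ℝ, ((N : ℝ≥0∞))⁻¹ *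
                ∫⁻ y, ∑ i, (‖y i - (((Matrix.circulant h).mulVec x i : ℝ) : ℂ)‖₊ : ℝ≥0∞) ^ 2
                  ∂(A x))
              ≤ ENNReal.ofReal
                  (C * c * (1 + Real.log N) ^ 2 * Real.log (1 / δ) / ((N : ℝ) * ε ^ 2))) ∧
          (2 < p →
            (⨆ x : Fin N → ℝ, ((N : ℝ≥0∞))⁻¹ *
                ∫⁻ y, ∑ i, (‖y i - (((Matrix.circulant h).mulVec x i : ℝ) : ℂ)‖₊ : ℝ≥0∞) ^ 2
                  ∂(A x))
              ≤ ENNReal.ofReal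
                  (C * c * (p / (p - 2)) ^ 2 * Real.log (1 / δ) / ((N : ℝ) * ε ^ 2))) := by
  refine ⟨40, by norm_num, ?_⟩
  intro N h c p hc hp hh ε δ hε h0 h1
  rcases eq_or_ne N 0 with rfl | hN
  · refine ⟨alg h 0 ε δ, alg_prob h 0 ε δ h0 h1, alg_dp h 0 ε δ hε, ?_, ?_⟩ <;>
    · intro _
      simp
  obtain ⟨a, ha, hb⟩ := compress_bd hN h c p hc hp hh
  have hNp : (0 : ℝ) < N := by exact_mod_cast Nat.pos_of_ne_zero hN
  have hl : 0 ≤ Real.log (1 / δ) := Real.log_nonneg (by rw [le_div_iff₀ h0]; linarith)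
  have herr := alg_err hN h a ε δ c hε h0 h1 hc ha hb
  refine ⟨alg h a ε δ, alg_prob h a ε δ h0 h1, alg_dp h a ε δ hε, ?_, ?_⟩
  · intro _
    refine herr.trans (ENNReal.ofReal_le_ofReal ?_)
    have hlN : 0 ≤ Real.log N := Real.log_natCast_nonneg N
    have h2 : (1 : ℝ) ≤ (1 + Real.log N) ^ 2 := one_le_pow₀ (by linarith)
    refine div_le_div_of_nonneg_right (mul_le_mul_of_nonneg_right ?_ hl) (by positivity)
    exact le_mul_of_one_le_right (by positivity) h2
  · intro hp2
    refine herr.trans (ENNReal.ofReal_le_ofReal ?_)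
    have h2 : (1 : ℝ) ≤ (p / (p - 2)) ^ 2 :=
      one_le_pow₀ (by rw [le_div_iff₀ (by linarith)]; linarith)
    refine div_le_div_of_nonneg_right (mul_le_mul_of_nonneg_right ?_ hl) (by positivity)
    exact le_mul_of_one_le_right (by positivity) h2

end
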